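/- Let B = ∏_{i ∈ I} B_i with each B_i ⊆ A_i nonempty be a best-reply-closed product set of a finite normal-form game: for every player i ∈ I, for every profile (σ_j)_{j ≠ i} of opponents' mixed strategies each of whose support is contained in B_j, every pure action a_i ∈ A_i that maximizes player i's expected payoff against (σ_j)_{j ≠ i} over all of A_i belongs to B_i. Then the game possesses a Nash equilibrium in mixed strategies σ* such that the support of σ*_i is contained in B_i for every player i. (This is the intermediate claim established in the proof of Theorem 1, where B_i is the set of player i's extensive-form rationalizable strategies: a Nash equilibrium of the game restricted to the best-reply-closed sets is a Nash equilibrium of the full game.) -/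

import Mathlib

/-- `σi` is a mixed strategy on the finite action set `A`: nonnegative and
summing to one. -/
def IsMixedStrategy {A : Type*} [Fintype A] (σi : A → ℝ) : Prop :=
  (∀ a, 0 ≤ σi a) ∧ ∑ a, σi a = 1

/-- The degenerate (pure) mixed strategy putting probability one on action `a`. -/
noncomputable def pureStrategy {A : Type*} [DecidableEq A] (a : A) : A → ℝ :=
  fun a' => if a' = a then 1 else 0

/-- Expected payoff of player `i` in a finite normal-form game with player set `I`,
action sets `A j`, and payoff functions `u`, given a profile of mixed strategies
`σ`. -/
def expectedPayoff {I : Type*} [Fintype I] [DecidableEq I] {A : I → Type*} [∀ j, Fintype (A j)]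
    (u : ∀ _ : I, (∀ j, A j) → ℝ) (σ : ∀ j, A j → ℝ) (i : I) : ℝ :=
  ∑ a : ∀ j, A j, (∏ j, σ j (a j)) * u i a

open Finset in
/-- In a finite set `S` of `card N` points coloured by `N` which is not rainbow, the number of
subsets with colours exactly `univ.erase i₀`, each used once, is even. -/
theorem even_card_doors_of_not_rainbow {V N : Type*} [Fintype V] [DecidableEq V] [Fintype N]
    [DecidableEq N] (c : V → N) (i₀ : N) (Q : Finset V → Prop) [DecidablePred Q]
    (hQ : ∀ R S, R ⊆ S → Q S → Q R) (S : Finset V) (hS : #S = Fintype.card N) (hQS : Q S)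
    (hc : S.image c ≠ univ) :
    Even #{R : Finset V | (#R + 1 = Fintype.card N ∧ Q R ∧ R.image c = univ.erase i₀) ∧ R ⊆ S} := by
  by_cases hne : ∃ R : Finset V,
      (#R + 1 = Fintype.card N ∧ Q R ∧ R.image c = univ.erase i₀) ∧ R ⊆ S
  swap
  · rw [filter_eq_empty_iff.2 fun R _ h => hne ⟨R, h⟩]
    simp
  obtain ⟨R, ⟨hR, -, hRc⟩, hRS⟩ := hne
  have inj : ∀ R' : Finset V, #R' + 1 = Fintype.card N → R'.image c = univ.erase i₀ →
      Set.InjOn c R' := by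
    intro R' h1 h2
    apply card_image_iff.1
    rw [h2, card_erase_of_mem (mem_univ _), card_univ]
    omega
  obtain ⟨x, hxR, rfl⟩ : ∃ x, x ∉ R ∧ insert x R = S := by
    obtain ⟨x, hx⟩ := card_eq_one.1 (show #(S \ R) = 1 by rw [card_sdiff_of_subset hRS]; omega)
    have hx' : x ∈ S \ R := by simp [hx]
    refine ⟨x, (mem_sdiff.1 hx').2, ?_⟩
    rw [insert_eq, ← hx, sdiff_union_of_subset hRS]
  have hx0 : c x ≠ i₀ := by
    rintro rfl
    apply hc
    rw [image_insert, hRc, insert_erase (mem_univ _)]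
  obtain ⟨x', hx'R, hx'⟩ : ∃ x' ∈ R, c x' = c x := by
    have : c x ∈ R.image c := by rw [hRc]; simp [hx0]
    simpa using this
  have hxx' : x ≠ x' := by rintro rfl; exact hxR hx'R
  have himg : ((insert x R).erase x').image c = univ.erase i₀ := by
    rw [← hRc]
    ext k
    simp only [mem_image, mem_erase, mem_insert]
    constructor
    · rintro ⟨w, ⟨_, rfl | hw⟩, rfl⟩
      · exact ⟨x', hx'R, hx'⟩
      · exact ⟨w, hw, rfl⟩
    · rintro ⟨w, hw, rfl⟩
      by_cases hwx : w = x'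
      · exact ⟨x, ⟨hxx', Or.inl rfl⟩, by rw [hwx, hx']⟩
      · exact ⟨w, ⟨hwx, Or.inr hw⟩, rfl⟩
  have hcard : #((insert x R).erase x') + 1 = Fintype.card N := by
    rw [card_erase_of_mem (by simp [hx'R]), hS]
    omega
  have key : ({R' : Finset V | (#R' + 1 = Fintype.card N ∧ Q R' ∧ R'.image c = univ.erase i₀) ∧
      R' ⊆ insert x R} : Finset (Finset V)) = {R, (insert x R).erase x'} := by
    ext R'
    simp only [mem_filter, mem_univ, true_and, mem_insert, mem_singleton]
    constructor
    · rintro ⟨⟨h1, -, h2⟩, h3⟩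
      have hinj := inj R' h1 h2
      by_cases hxR' : x ∈ R'
      · right
        have hn : x' ∉ R' := fun h => hxx' (hinj hxR' h hx'.symm)
        exact eq_of_subset_of_card_le (subset_erase.2 ⟨h3, hn⟩) (by omega)
      · left
        exact eq_of_subset_of_card_le ((subset_insert_iff_of_notMem hxR').1 h3) (by omega)
    · rintro (rfl | rfl)
      · exact ⟨⟨hR, hQ _ _ hRS hQS, hRc⟩, hRS⟩
      · exact ⟨⟨hcard, hQ _ _ (erase_subset _ _) hQS, himg⟩, erase_subset _ _⟩
  rw [key, card_pair]
  · exact even_two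
  · intro h
    exact (notMem_erase x' (insert x R)) (h ▸ hx'R)

/-- A finite set `S` is dominant for the utilities `v i` if no point is strictly better than the
`v i`-minimum of `S` for every `i`. -/
def IsDominant {V N : Type*} (v : N → V → ℕ) (S : Finset V) : Prop :=
  ∀ y, ∃ i, ∀ x ∈ S, v i y ≤ v i x

theorem IsDominant.mono {V N : Type*} {v : N → V → ℕ} {R S : Finset V} (h : R ⊆ S)
    (hS : IsDominant v S) : IsDominant v R := fun y => by
  obtain ⟨i, hi⟩ := hS y
  exact ⟨i, fun x hx => hi x (h hx)⟩

open Finset in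
/-- A nonempty dominant set with `card N - 1` points extends to a dominant set in exactly two ways,
provided that the regions above all minima but one are nonempty. -/
theorem IsDominant.exists_two_extensions {V N : Type*} [Fintype V] [DecidableEq V] [Fintype N]
    {v : N → V → ℕ} (hv : ∀ i, Function.Injective (v i)) {R : Finset V}
    (hR : IsDominant v R) (hcard : #R + 1 = Fintype.card N) (hne : R.Nonempty)
    (hM : ∀ a, ∃ y, ∀ i, i ≠ a → ∃ x ∈ R, v i x < v i y) :
    ∃ x y, x ≠ y ∧ x ∉ R ∧ y ∉ R ∧
      ∀ z, z ∉ R → (IsDominant v (insert z R) ↔ z = x ∨ z = y) := by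
  classical
  choose m hmR hm using fun i => exists_min_image R (v i) hne
  have hsurj : ∀ x ∈ R, ∃ i, m i = x := fun x hx => by
    obtain ⟨i, hi⟩ := hR x
    exact ⟨i, hv i (le_antisymm (hm i x hx) (hi _ (hmR i)))⟩
  obtain ⟨a, -, b, -, hab, hmab⟩ := exists_ne_map_eq_of_card_lt_of_maps_to
    (s := (univ : Finset N)) (t := R) (f := m) (by rw [card_univ]; omega) (fun i _ => hmR i)
  have injOff : ∀ a b, a ≠ b → m a = m b → Set.InjOn m (univ.erase a : Finset N) := by
    intro a b hab hmab
    apply card_image_iff.1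
    have : (univ.erase a).image m = R := by
      ext x
      simp only [mem_image, mem_erase, mem_univ, and_true]
      constructor
      · rintro ⟨i, _, rfl⟩; exact hmR i
      · intro hx
        obtain ⟨i, rfl⟩ := hsurj x hx
        by_cases hi : i = a
        · exact ⟨b, hab.symm, by rw [hi, hmab]⟩
        · exact ⟨i, hi, rfl⟩
    rw [this, card_erase_of_mem (mem_univ _), card_univ]
    omega
  have pair : ∀ i j, i ≠ j → m i = m j → (i = a ∨ i = b) ∧ (j = a ∨ j = b) := by
    intro i j hij hmij
    have ha := injOff a b hab hmab
    have hb := injOff b a hab.symm hmab.symm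
    have h1 : i = a ∨ j = a := by
      by_contra! h
      exact hij (ha (by simp [h.1]) (by simp [h.2]) hmij)
    have h2 : i = b ∨ j = b := by
      by_contra! h
      exact hij (hb (by simp [h.1]) (by simp [h.2]) hmij)
    grind
  have hmax : ∀ a, ∃ x, (∀ i, i ≠ a → v i (m i) < v i x) ∧
      ∀ y, (∀ i, i ≠ a → v i (m i) < v i y) → v a y ≤ v a x := by
    intro a
    obtain ⟨y, hy⟩ := hM a
    obtain ⟨x, hx, hx'⟩ := exists_max_image
      ({y | ∀ i, i ≠ a → v i (m i) < v i y} : Finset V) (v a) ⟨y, by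
        simp only [mem_filter, mem_univ, true_and]
        intro i hi
        obtain ⟨x, hx, hxy⟩ := hy i hi
        exact (hm i x hx).trans_lt hxy⟩
    exact ⟨x, by simpa using hx, fun y hy => hx' y (by simpa using hy)⟩
  have notMem : ∀ a b x, a ≠ b → m a = m b → (∀ i, i ≠ a → v i (m i) < v i x) → x ∉ R := by
    intro a b x hab hmab hx hxR
    obtain ⟨i, rfl⟩ := hsurj x hxR
    by_cases hi : i = a
    · have := hx b hab.symm
      rw [hi, hmab] at this
      exact lt_irrefl _ this
    · exact lt_irrefl _ (hx i hi)
  have dom : ∀ a x, (∀ i, i ≠ a → v i (m i) < v i x) →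
      (∀ y, (∀ i, i ≠ a → v i (m i) < v i y) → v a y ≤ v a x) → IsDominant v (insert x R) := by
    intro a x hx hxmax y
    by_cases hy : ∀ i, i ≠ a → v i (m i) < v i y
    · refine ⟨a, fun z hz => ?_⟩
      rcases mem_insert.1 hz with rfl | hz
      · exact hxmax y hy
      · obtain ⟨i, hi⟩ := hR y
        by_cases hia : i = a
        · exact hia ▸ hi z hz
        · exact absurd (hi _ (hmR i)) (not_le.2 (hy i hia))
    · push Not at hy
      obtain ⟨i, hia, hi⟩ := hy
      refine ⟨i, fun z hz => ?_⟩
      rcases mem_insert.1 hz with rfl | hz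
      · exact hi.trans (hx i hia).le
      · exact hi.trans (hm i z hz)
  obtain ⟨x, hx, hxmax⟩ := hmax a
  obtain ⟨y, hy, hymax⟩ := hmax b
  refine ⟨x, y, ?_, notMem a b x hab hmab hx, notMem b a y hab.symm hmab.symm hy, ?_⟩
  · rintro rfl
    obtain ⟨i, hi⟩ := hR x
    have := hi _ (hmR i)
    by_cases hia : i = a
    · exact absurd this (not_le.2 (hy i (hia ▸ hab)))
    · exact absurd this (not_le.2 (hx i hia))
  · intro z hz
    constructor
    · intro hdom
      obtain ⟨k, hk⟩ := hdom z
      have hidx : ∀ i, ∃ j, j ≠ k ∧ m j = m i ∧ v j (m j) < v j z := by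
        intro i
        obtain ⟨j, hj⟩ := hdom (m i)
        have hji : m j = m i := hv j
          (le_antisymm (hm j _ (hmR i)) (hj _ (mem_insert_of_mem (hmR j))))
        have hlt : v j (m j) < v j z := by
          refine lt_of_le_of_ne (hji ▸ hj z (mem_insert_self _ _)) fun h => hz ?_
          rw [← hv j h]
          exact hmR j
        refine ⟨j, ?_, hji, hlt⟩
        rintro rfl
        exact absurd (hk _ (mem_insert_of_mem (hmR j))) (not_le.2 hlt)
      obtain ⟨l, hlk, hml, -⟩ := hidx k
      have hkinj := injOff k l hlk.symm hml.symm
      have hzM : ∀ i, i ≠ k → v i (m i) < v i z := by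
        intro i hi
        obtain ⟨j, hjk, hmj, hj⟩ := hidx i
        have : j = i := hkinj (by simp [hjk]) (by simp [hi]) hmj
        exact this ▸ hj
      have hzmax : ∀ y, (∀ i, i ≠ k → v i (m i) < v i y) → v k y ≤ v k z := by
        intro y hy
        obtain ⟨i, hi⟩ := hdom y
        by_cases hik : i = k
        · exact hik ▸ hi z (mem_insert_self _ _)
        · exact absurd (hi _ (mem_insert_of_mem (hmR i))) (not_le.2 (hy i hik))
      rcases (pair l k hlk hml).2 with rfl | rfl
      · exact Or.inl (hv _ (le_antisymm (hxmax z hzM) (hzmax x hx)))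
      · exact Or.inr (hv _ (le_antisymm (hymax z hzM) (hzmax y hy)))
    · rintro (rfl | rfl)
      · exact dom a _ hx hxmax
      · exact dom b _ hy hymax

open Finset in
/-- The finite sets extending `R` by one point, described through the added point. -/
theorem filter_superset_card_succ {V : Type*} [Fintype V] [DecidableEq V]
    (Q : Finset V → Prop) [DecidablePred Q] (R : Finset V) (n : ℕ) (hR : #R + 1 = n) :
    ({S : Finset V | (#S = n ∧ Q S) ∧ R ⊆ S} : Finset (Finset V)) =
      ({z | z ∉ R ∧ Q (insert z R)} : Finset V).image (insert · R) := by
  ext S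
  simp only [mem_filter, mem_univ, true_and, mem_image]
  constructor
  · rintro ⟨⟨h1, h2⟩, h3⟩
    obtain ⟨x, hx⟩ := card_eq_one.1 (show #(S \ R) = 1 by rw [card_sdiff_of_subset h3]; omega)
    have hx' : x ∈ S \ R := by simp [hx]
    have hS : insert x R = S := by rw [insert_eq, ← hx, sdiff_union_of_subset h3]
    exact ⟨x, ⟨(mem_sdiff.1 hx').2, hS ▸ h2⟩, hS⟩
  · rintro ⟨x, ⟨h1, h2⟩, rfl⟩
    exact ⟨⟨by rw [card_insert_of_notMem h1, hR], h2⟩, subset_insert _ _⟩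

open Finset in
/-- **Scarf's lemma**, with corner points `d i`: there is a rainbow dominant set. -/
theorem exists_rainbow_isDominant {V N : Type*} [Fintype V] [Fintype N] [DecidableEq N]
    [Nonempty N] (v : N → V → ℕ) (hv : ∀ i, Function.Injective (v i)) (d : N → V)
    (hd : Function.Injective d)
    (hmin : ∀ i y, v i (d i) ≤ v i y)
    (hbig : ∀ i j y, j ≠ i → y ∉ Set.range d → v i y < v i (d j))
    (c : V → N) (hc : ∀ i, c (d i) = i) :
    ∃ S : Finset V, IsDominant v S ∧ ∀ i, ∃ x ∈ S, c x = i := by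
  classical
  by_contra hno
  obtain ⟨i₀⟩ := ‹Nonempty N›
  have hrain : ∀ S : Finset V, IsDominant v S → S.image c ≠ univ := by
    intro S hS h
    refine hno ⟨S, hS, fun i => ?_⟩
    have : i ∈ S.image c := h ▸ mem_univ i
    simpa using this
  let doors : Finset (Finset V) :=
    {R | #R + 1 = Fintype.card N ∧ IsDominant v R ∧ R.image c = univ.erase i₀}
  let rooms : Finset (Finset V) := {S | #S = Fintype.card N ∧ IsDominant v S}
  have hcount := sum_card_bipartiteAbove_eq_sum_card_bipartiteBelow
    (s := doors) (t := rooms) (fun R S => R ⊆ S)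
  have hright : Even (∑ S ∈ rooms, #(bipartiteBelow (fun R S => R ⊆ S) doors S)) := by
    refine even_sum _ fun S hS => ?_
    have hS' := (mem_filter.1 hS).2
    have := even_card_doors_of_not_rainbow c i₀ (IsDominant v) (fun _ _ => IsDominant.mono)
      S hS'.1 hS'.2 (hrain S hS'.2)
    rwa [bipartiteBelow, filter_filter]
  let R₀ : Finset V := (univ.erase i₀).image d
  have hR₀card : #R₀ + 1 = Fintype.card N := by
    rw [card_image_of_injective _ hd, card_erase_of_mem (mem_univ _), card_univ]
    have := Fintype.card_pos_iff.2 ⟨i₀⟩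
    omega
  have habove : ∀ R, #R + 1 = Fintype.card N → #(bipartiteAbove (fun R S => R ⊆ S) rooms R) =
      #({z | z ∉ R ∧ IsDominant v (insert z R)} : Finset V) := by
    intro R hR
    rw [bipartiteAbove, filter_filter, filter_superset_card_succ _ R _ hR]
    refine card_image_of_injOn fun x hx y hy hxy => ?_
    have hx' := (mem_filter.1 hx).2.1
    have hxy' : insert x R = insert y R := hxy
    have : x ∈ insert y R := hxy' ▸ mem_insert_self x R
    exact (mem_insert.1 this).resolve_right hx'
  have hdi₀ : d i₀ ∉ R₀ := by simp [R₀, hd.eq_iff]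
  have hcorner : ∃ x, ∀ z, (z ∉ R₀ ∧ IsDominant v (insert z R₀)) ↔ z = x := by
    obtain ⟨x, hx, hxmax⟩ := exists_max_image R₀ᶜ (v i₀) ⟨d i₀, by simpa using hdi₀⟩
    rw [mem_compl] at hx
    refine ⟨x, fun z => ⟨?_, ?_⟩⟩
    · rintro ⟨hz, hdom⟩
      obtain ⟨i, hi⟩ := hdom x
      have hii : i = i₀ := by
        by_contra hii
        have hm : d i ∈ R₀ := mem_image_of_mem _ (by simp [hii])
        have := hv i (le_antisymm (hi _ (mem_insert_of_mem hm)) (hmin i x))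
        exact hx (this ▸ hm)
      subst hii
      exact hv i (le_antisymm (hxmax z (by simpa using hz)) (hi z (mem_insert_self _ _)))
    · rintro rfl
      refine ⟨hx, fun y => ?_⟩
      by_cases hy : y ∈ R₀
      · obtain ⟨j, -, rfl⟩ := mem_image.1 hy
        exact ⟨j, fun w _ => hmin j w⟩
      · refine ⟨i₀, fun w hw => ?_⟩
        rcases mem_insert.1 hw with rfl | hw
        · exact hxmax y (by simpa using hy)
        · obtain ⟨j, hj, rfl⟩ := mem_image.1 hw
          by_cases hyd : y ∈ Set.range d
          · obtain ⟨k, rfl⟩ := hyd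
            have hk : k = i₀ := by
              by_contra hk
              exact hy (mem_image_of_mem _ (by simp [hk]))
            exact hk ▸ hmin k _
          · exact (hbig i₀ j y (by simpa using hj) hyd).le
  obtain ⟨x₀, hx₀⟩ := hcorner
  have hR₀ : R₀ ∈ doors := by
    refine mem_filter.2 ⟨mem_univ _, hR₀card,
      ((hx₀ x₀).2 rfl).2.mono (subset_insert _ _), ?_⟩
    rw [image_image, show c ∘ d = id from funext hc, image_id]
  have hone : #(bipartiteAbove (fun R S => R ⊆ S) rooms R₀) = 1 := by
    rw [habove _ hR₀card, card_eq_one]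
    exact ⟨x₀, by ext z; simp only [mem_filter, mem_univ, true_and, mem_singleton, hx₀]⟩
  have heven : ∀ R ∈ doors.erase R₀, Even #(bipartiteAbove (fun R S => R ⊆ S) rooms R) := by
    intro R hR
    obtain ⟨hne, hR⟩ := mem_erase.1 hR
    obtain ⟨hcard, hdom, hcol⟩ := (mem_filter.1 hR).2
    obtain ⟨t, htR, ht⟩ : ∃ t ∈ R, t ∉ Set.range d := by
      by_contra! h
      refine hne (eq_of_subset_of_card_le (fun x hx => ?_) (by omega))
      obtain ⟨j, rfl⟩ := h x hx
      have : c (d j) ∈ R.image c := mem_image_of_mem _ hx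
      rw [hcol, hc] at this
      exact mem_image_of_mem _ this
    obtain ⟨x, y, hxy, hx, hy, h⟩ := hdom.exists_two_extensions hv hcard ⟨t, htR⟩
      fun a => ⟨d a, fun i hi => ⟨t, htR, hbig i a t hi.symm ht⟩⟩
    have : ({z | z ∉ R ∧ IsDominant v (insert z R)} : Finset V) = {x, y} := by
      ext z
      simp only [mem_filter, mem_univ, true_and, mem_insert, mem_singleton]
      constructor
      · rintro ⟨h1, h2⟩
        exact (h z h1).1 h2
      · intro hz
        have hzR : z ∉ R := by rcases hz with rfl | rfl <;> assumption
        exact ⟨hzR, (h z hzR).2 hz⟩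
    rw [habove _ hcard, this, card_pair hxy]
    exact even_two
  rw [← hcount, ← add_sum_erase _ _ hR₀, hone] at hright
  have := even_sum _ heven
  rw [Nat.even_add] at hright
  exact absurd (hright.2 this) (by decide)

open Finset in
/-- Scarf's lemma for arbitrary (possibly non-injective) utilities on a finite set. -/
theorem exists_dominant_pair {T N : Type*} [Finite T] [Nonempty T] [Fintype N] [Nonempty N]
    (w : N → T → ℕ) (c : T → N) :
    ∃ (σ : Finset T) (C : Finset N), σ.Nonempty ∧ (∀ i ∈ C, ∃ x ∈ σ, c x = i) ∧
      ∀ y, ∃ i ∈ C, ∀ x ∈ σ, w i y ≤ w i x := by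
  classical
  have := Fintype.ofFinite T
  let e := Fintype.equivFin T
  let eN := Fintype.equivFin N
  let K := Fintype.card T
  let L := ∑ i, ∑ x, (w i x * K + K + 1)
  have hL : ∀ i x, 1 + (w i x * K + e x) < L := by
    intro i x
    have h1 : w i x * K + K + 1 ≤ L :=
      (single_le_sum (f := fun x => w i x * K + K + 1) (fun _ _ => Nat.zero_le _)
        (mem_univ x)).trans
      (single_le_sum (f := fun i => ∑ x, (w i x * K + K + 1)) (fun _ _ => Nat.zero_le _)
        (mem_univ i))
    have := (e x).2
    omega
  let v : N → T ⊕ N → ℕ := fun i =>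
    Sum.elim (fun x => 1 + (w i x * K + e x)) (fun j => if j = i then 0 else L + eN j)
  have hlex : ∀ i x y, w i x * K + e x ≤ w i y * K + e y → w i x ≤ w i y := by
    intro i x y h
    by_contra! hlt
    have h1 : (w i y + 1) * K ≤ w i x * K := Nat.mul_le_mul_right _ hlt
    have := (e y).2
    rw [add_mul] at h1
    omega
  have hv : ∀ i, Function.Injective (v i) := by
    rintro i (x | j) (y | k) h
    · simp only [v, Sum.elim_inl] at h
      have hw : w i x = w i y := le_antisymm (hlex i x y (by omega)) (hlex i y x (by omega))
      rw [hw] at h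
      rw [e.injective (Fin.ext (by omega : (e x : ℕ) = e y))]
    · simp only [v, Sum.elim_inl, Sum.elim_inr] at h
      have := hL i x
      split_ifs at h <;> omega
    · simp only [v, Sum.elim_inl, Sum.elim_inr] at h
      have := hL i y
      split_ifs at h <;> omega
    · obtain ⟨t⟩ := ‹Nonempty T›
      have hpos := hL i t
      simp only [v, Sum.elim_inr] at h
      split_ifs at h with h1 h2 h2
      · rw [h1, h2]
      · omega
      · omega
      · rw [eN.injective (Fin.ext (by omega : (eN j : ℕ) = eN k))]
  obtain ⟨S, hS, hcol⟩ := exists_rainbow_isDominant v hv Sum.inr Sum.inr_injective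
    (fun i y => by simp [v])
    (by
      rintro i j (x | k) hj hy
      · have := hL i x
        simp only [v, Sum.elim_inl, Sum.elim_inr, if_neg hj]
        omega
      · exact absurd ⟨k, rfl⟩ hy)
    (Sum.elim c id) (fun i => rfl)
  have hC : ∀ i, Sum.inr i ∉ S → ∃ x, Sum.inl x ∈ S ∧ c x = i := by
    intro i hi
    obtain ⟨x | j, hx, hxi⟩ := hcol i
    · exact ⟨x, hx, hxi⟩
    · have : j = i := hxi
      exact absurd (this ▸ hx) hi
  have hdom : ∀ y, ∃ i, Sum.inr i ∉ S ∧ ∀ x, Sum.inl x ∈ S → w i y ≤ w i x := by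
    intro y
    obtain ⟨i, hi⟩ := hS (Sum.inl y)
    refine ⟨i, fun h => ?_, fun x hx => hlex i y x ?_⟩
    · simpa [v] using hi _ h
    · have := hi _ hx
      simp only [v, Sum.elim_inl] at this
      omega
  refine ⟨({x | Sum.inl x ∈ S} : Finset T), ({i | Sum.inr i ∉ S} : Finset N), ?_, ?_, ?_⟩
  · obtain ⟨i, hi, -⟩ := hdom (Classical.arbitrary T)
    obtain ⟨x, hx, -⟩ := hC i hi
    exact ⟨x, by simpa using hx⟩
  · intro i hi
    simpa using hC i (by simpa using hi)
  · intro y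
    simpa using hdom y

open Finset in
/-- Points of a dominant pair in the grid of naturals with sum `n` are close to each other, and
almost vanish off `C`. -/
theorem exists_lower_bound_of_dominant_pair {N : Type*} [Fintype N] {n : ℕ}
    {σ : Finset {x : N → ℕ // ∑ i, x i = n}} {C : Finset N} (hσ : σ.Nonempty)
    (h : ∀ y : {x : N → ℕ // ∑ i, x i = n}, ∃ i ∈ C, ∀ x ∈ σ, y.1 i ≤ x.1 i) :
    ∃ m : N → ℕ, (∀ i, i ∉ C → m i = 0) ∧
      ∀ x ∈ σ, ∀ i, m i ≤ x.1 i ∧ x.1 i ≤ m i + Fintype.card N := by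
  classical
  choose q hq hqmin using fun i => exists_min_image σ (fun x => x.1 i) hσ
  let m : N → ℕ := fun i => if i ∈ C then (q i).1 i else 0
  have hm : ∀ x ∈ σ, ∀ i, m i ≤ x.1 i := by
    intro x hx i
    by_cases hi : i ∈ C
    · simpa [m, hi] using hqmin i x hx
    · simp [m, hi]
  have hsum : n ≤ ∑ i, (m i + 1) := by
    by_contra! hlt
    obtain ⟨x, hx⟩ := hσ
    obtain ⟨j, hj, -⟩ := h x
    obtain ⟨i, hi, hle⟩ := h
      ⟨fun i => m i + 1 + if i = j then n - ∑ i, (m i + 1) else 0, by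
        rw [sum_add_distrib, sum_ite_eq' univ j, if_pos (mem_univ _)]
        omega⟩
    have := hle _ (hq i)
    simp only [m, if_pos hi] at this
    omega
  refine ⟨m, fun i hi => by simp [m, hi], fun x hx i => ⟨hm x hx i, ?_⟩⟩
  rw [sum_add_distrib, sum_const, card_univ, smul_eq_mul, mul_one] at hsum
  have h1 : ∑ k ∈ univ.erase i, m k ≤ ∑ k ∈ univ.erase i, x.1 k :=
    sum_le_sum fun k _ => hm x hx k
  have h2 := add_sum_erase univ m (mem_univ i)
  have h3 := add_sum_erase univ x.1 (mem_univ i)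
  have h4 := x.2
  omega

/-- Approximate Knaster–Kuratowski–Mazurkiewicz property for a cover of the simplex. -/
theorem exists_approx_mem_of_cover_stdSimplex {N : Type*} [Fintype N] [Nonempty N]
    (F : N → Set (N → ℝ)) (hF : ∀ x ∈ stdSimplex ℝ N, ∃ i, x ∈ F i) {ε : ℝ} (hε : 0 < ε) :
    ∃ p ∈ stdSimplex ℝ N, ∀ i, p i ≤ ε ∨ ∃ q ∈ F i, dist q p ≤ ε := by
  classical
  obtain ⟨n, hn⟩ := exists_nat_gt (Fintype.card N / ε)
  have hn0 : (0 : ℝ) < n := lt_of_le_of_lt (by positivity) hn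
  have hnε : (Fintype.card N : ℝ) / n ≤ ε := by
    rw [div_lt_iff₀ hε] at hn
    rw [div_le_iff₀ hn0]
    linarith
  let T := {x : N → ℕ // ∑ i, x i = n}
  have : Finite T := by
    have hle : ∀ x : T, ∀ i, x.1 i < n + 1 := fun x i => by
      have := Finset.single_le_sum (f := x.1) (fun _ _ => Nat.zero_le _) (Finset.mem_univ i)
      rw [x.2] at this
      omega
    refine Finite.of_injective (fun (x : T) (i : N) => (⟨x.1 i, hle x i⟩ : Fin (n + 1))) ?_
    intro x y hxy
    refine Subtype.ext (funext fun i => ?_)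
    simpa using congrFun hxy i
  have : Nonempty T := ⟨⟨Pi.single (Classical.arbitrary N) n, by simp⟩⟩
  let P : T → N → ℝ := fun x i => x.1 i / n
  have hP : ∀ x, P x ∈ stdSimplex ℝ N := fun x => by
    refine ⟨fun i => by positivity, ?_⟩
    simp only [P]
    rw [← Finset.sum_div, ← Nat.cast_sum, x.2, div_self hn0.ne']
  choose c hc using fun x => hF (P x) (hP x)
  obtain ⟨σ, C, hσ, hcol, hdom⟩ := exists_dominant_pair (fun i (x : T) => x.1 i) c
  obtain ⟨m, hm0, hm⟩ := exists_lower_bound_of_dominant_pair hσ hdom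
  obtain ⟨x, hx⟩ := hσ
  refine ⟨P x, hP x, fun i => ?_⟩
  by_cases hi : i ∈ C
  · right
    obtain ⟨y, hy, rfl⟩ := hcol i hi
    refine ⟨P y, hc y, (dist_pi_le_iff hε.le).2 fun k => le_trans ?_ hnε⟩
    obtain ⟨h1, h2⟩ := hm x hx k
    obtain ⟨h3, h4⟩ := hm y hy k
    rify at h1 h2 h3 h4
    simp only [P]
    rw [Real.dist_eq, ← sub_div, abs_div, abs_of_pos hn0]
    gcongr
    rw [abs_le]
    constructor <;> linarith
  · left
    refine le_trans ?_ hnε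
    have h1 := (hm x hx i).2
    rw [hm0 i hi, zero_add] at h1
    simp only [P]
    gcongr

open Filter Topology in
/-- If closed sets `F i` cover the simplex, some point of the simplex lies in `F i` for every `i`
in its support. -/
theorem exists_mem_of_closed_cover_stdSimplex {N : Type*} [Fintype N] [Nonempty N]
    (F : N → Set (N → ℝ)) (hcl : ∀ i, IsClosed (F i))
    (hF : ∀ x ∈ stdSimplex ℝ N, ∃ i, x ∈ F i) :
    ∃ p ∈ stdSimplex ℝ N, ∀ i, 0 < p i → p ∈ F i := by
  choose p hp hpF using fun n : ℕ =>
    exists_approx_mem_of_cover_stdSimplex F hF (ε := 1 / ((n : ℝ) + 1)) (by positivity)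
  obtain ⟨x, hx, φ, hφ, hlim⟩ := (isCompact_stdSimplex ℝ N).tendsto_subseq hp
  refine ⟨x, hx, fun i hi => ?_⟩
  have hε : Tendsto (fun n => 1 / ((φ n : ℝ) + 1)) atTop (𝓝 0) :=
    tendsto_one_div_add_atTop_nhds_zero_nat.comp hφ.tendsto_atTop
  have hlimi : Tendsto (fun n => p (φ n) i) atTop (𝓝 (x i)) := (tendsto_pi_nhds.1 hlim) i
  rw [← (hcl i).closure_eq, Metric.mem_closure_iff]
  intro δ hδ
  have h1 : ∀ᶠ n in atTop, 1 / ((φ n : ℝ) + 1) < p (φ n) i := hε.eventually_lt hlimi hi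
  have h2 : ∀ᶠ n in atTop, 1 / ((φ n : ℝ) + 1) < δ / 2 := hε.eventually_lt_const (by positivity)
  have h3 : ∀ᶠ n in atTop, dist (p (φ n)) x < δ / 2 :=
    Metric.tendsto_nhds.1 hlim _ (by positivity)
  obtain ⟨n, h1, h2, h3⟩ := (h1.and (h2.and h3)).exists
  obtain ⟨q, hq, hqp⟩ := (hpF (φ n) i).resolve_left (not_le.2 h1)
  refine ⟨q, hq, ?_⟩
  have := dist_triangle q (p (φ n)) x
  rw [dist_comm]
  linarith

theorem continuous_expectedPayoff {I : Type*} [Fintype I] [DecidableEq I] {A : I → Type*}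
    [∀ j, Fintype (A j)] (u : ∀ _ : I, (∀ j, A j) → ℝ) (i : I) :
    Continuous fun σ : ∀ j, A j → ℝ => expectedPayoff u σ i := by
  unfold expectedPayoff
  fun_prop

/-- The expected payoff is linear in the player's own strategy. -/
theorem expectedPayoff_update_eq_sum {I : Type*} [Fintype I] [DecidableEq I] {A : I → Type*}
    [∀ j, Fintype (A j)] [∀ j, DecidableEq (A j)] (u : ∀ _ : I, (∀ j, A j) → ℝ)
    (σ : ∀ j, A j → ℝ) (i : I) (τ : A i → ℝ) :
    expectedPayoff u (Function.update σ i τ) i =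
      ∑ b, τ b * expectedPayoff u (Function.update σ i (pureStrategy b)) i := by
  have hprod : ∀ (ρ : A i → ℝ) (a : ∀ j, A j), ∏ j, Function.update σ i ρ j (a j) =
      ρ (a i) * ∏ j ∈ Finset.univ.erase i, σ j (a j) := by
    intro ρ a
    rw [← Finset.mul_prod_erase _ _ (Finset.mem_univ i), Function.update_self]
    congr 1
    refine Finset.prod_congr rfl fun j hj => ?_
    rw [Function.update_of_ne (Finset.ne_of_mem_erase hj)]
  simp only [expectedPayoff, hprod, Finset.mul_sum]
  rw [Finset.sum_comm]
  refine Finset.sum_congr rfl fun a _ => ?_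
  rw [Finset.sum_eq_single (a i)]
  · simp [pureStrategy, mul_assoc]
  · intro b _ hb
    simp [pureStrategy, hb.symm]
  · simp

/-- A game has a profile of mixed strategies supported in the nonempty sets `B i` that is an
equilibrium of the game restricted to `B`. -/
theorem exists_restricted_equilibrium {I : Type*} [Fintype I] [Nonempty I] [DecidableEq I]
    {A : I → Type*} [∀ i, Fintype (A i)] [∀ i, DecidableEq (A i)]
    (u : ∀ _ : I, (∀ j, A j) → ℝ) (B : ∀ i, Set (A i)) (hBne : ∀ i, (B i).Nonempty) :
    ∃ σ : ∀ j, A j → ℝ, (∀ i, IsMixedStrategy (σ i)) ∧ (∀ i a, 0 < σ i a → a ∈ B i) ∧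
      ∀ i a, 0 < σ i a → ∀ b ∈ B i,
        expectedPayoff u (Function.update σ i (pureStrategy b)) i ≤
          expectedPayoff u (Function.update σ i (pureStrategy a)) i := by
  classical
  have hcard : (0 : ℝ) < Fintype.card I := by exact_mod_cast Fintype.card_pos
  have hBne' : ∀ i, Nonempty (B i) := fun i => (hBne i).to_subtype
  let N := Σ i, B i
  have : Nonempty N := ‹Nonempty I›.elim fun i => ⟨⟨i, Classical.choice (hBne' i)⟩⟩
  let Z : (N → ℝ) → ∀ j, A j → ℝ := fun z j a =>
    if h : a ∈ B j then Fintype.card I * z ⟨j, a, h⟩ else 0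
  have hZ : Continuous Z := by
    refine continuous_pi fun j => continuous_pi fun a => ?_
    by_cases h : a ∈ B j
    · simp only [Z, h, dite_true]
      fun_prop
    · simp only [Z, h, dite_false]
      fun_prop
  let F : N → Set (N → ℝ) := fun k =>
    {z | ∑ b, z ⟨k.1, b⟩ ≤ 1 / Fintype.card I} ∩
      ⋂ b : B k.1, {z | expectedPayoff u (Function.update (Z z) k.1 (pureStrategy b.1)) k.1 ≤
        expectedPayoff u (Function.update (Z z) k.1 (pureStrategy k.2.1)) k.1}
  have hEP : ∀ (i : I) (a : A i), Continuous fun z =>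
      expectedPayoff u (Function.update (Z z) i (pureStrategy a)) i := fun i a =>
    (continuous_expectedPayoff u i).comp (hZ.update i continuous_const)
  have hcl : ∀ k, IsClosed (F k) := fun k =>
    (isClosed_le (by fun_prop) continuous_const).inter
      (isClosed_iInter fun b => isClosed_le (hEP _ _) (hEP _ _))
  have hsum : ∀ z ∈ stdSimplex ℝ N, ∑ i, ∑ b, z ⟨i, b⟩ = 1 := fun z hz => by
    rw [← hz.2, Fintype.sum_sigma]
  have hsum1 : ∑ _i : I, (1 : ℝ) / Fintype.card I = 1 := by
    rw [Finset.sum_const, Finset.card_univ, nsmul_eq_mul, mul_one_div_cancel hcard.ne']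
  have hcov : ∀ z ∈ stdSimplex ℝ N, ∃ k, z ∈ F k := by
    intro z hz
    obtain ⟨i, -, hi⟩ := Finset.exists_le_of_sum_le (s := Finset.univ)
      (f := fun i => ∑ b, z ⟨i, b⟩) (g := fun _ => (1 : ℝ) / Fintype.card I)
      Finset.univ_nonempty (by rw [hsum z hz, hsum1])
    obtain ⟨b, hb⟩ := Finite.exists_max fun b : B i =>
      expectedPayoff u (Function.update (Z z) i (pureStrategy b.1)) i
    exact ⟨⟨i, b⟩, hi, Set.mem_iInter.2 hb⟩
  obtain ⟨z, hz, hzF⟩ := exists_mem_of_closed_cover_stdSimplex F hcl hcov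
  have hle : ∀ i ∈ Finset.univ, ∑ b, z ⟨i, b⟩ ≤ 1 / Fintype.card I := by
    intro i _
    by_contra! hlt
    obtain ⟨b, -, hb⟩ := Finset.exists_lt_of_sum_lt (s := Finset.univ)
      (f := fun _ : B i => (0 : ℝ)) (g := fun b => z ⟨i, b⟩)
      (by rw [Finset.sum_const_zero]; exact lt_trans (by positivity) hlt)
    exact absurd (hzF ⟨i, b⟩ hb).1 (not_le.2 hlt)
  have heq : ∀ i, ∑ b, z ⟨i, b⟩ = 1 / Fintype.card I := fun i =>
    (Finset.sum_eq_sum_iff_of_le hle).1 (by rw [hsum z hz, hsum1]) i (Finset.mem_univ i)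
  have hsupp : ∀ i a, 0 < Z z i a → ∃ h : a ∈ B i, 0 < z ⟨i, a, h⟩ := by
    intro i a ha
    by_cases h : a ∈ B i
    · simp only [Z, h, dite_true] at ha
      exact ⟨h, pos_of_mul_pos_right ha hcard.le⟩
    · simp [Z, h] at ha
  refine ⟨Z z, fun i => ⟨fun a => ?_, ?_⟩, fun i a ha => (hsupp i a ha).1, fun i a ha b hb => ?_⟩
  · by_cases h : a ∈ B i
    · simp only [Z, h, dite_true]
      exact mul_nonneg hcard.le (hz.1 _)
    · simp [Z, h]
  · have h1 : ∑ a, Z z i a = ∑ b : B i, Fintype.card I * z ⟨i, b⟩ := by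
      rw [← Finset.sum_subset (Finset.subset_univ (Finset.univ.filter (· ∈ B i)))
        (fun a _ ha => by
          have : a ∉ B i := by simpa using ha
          simp [Z, this])]
      rw [Finset.sum_subtype (p := (· ∈ B i)) _ (by simp)]
      refine Finset.sum_congr rfl fun b _ => ?_
      simp [Z]
    rw [h1, ← Finset.mul_sum, heq, mul_one_div_cancel hcard.ne']
  · obtain ⟨h, hpos⟩ := hsupp i a ha
    exact Set.mem_iInter.1 (hzF ⟨i, a, h⟩ hpos).2 ⟨b, hb⟩

/-- **Nash equilibrium on best-reply-closed product sets.** Let `B i ⊆ A i` be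
nonempty sets such that for every player `i` and every profile of mixed strategies
whose opponents' components have supports contained in the corresponding `B j`,
every pure action of `i` that maximizes `i`'s expected payoff against that profile
over all of `A i` belongs to `B i`. Then the game has a Nash equilibrium in mixed
strategies `σ*` with the support of `σ* i` contained in `B i` for every `i`. -/
theorem exists_nash_equilibrium_of_bestReplyClosed {I : Type*} [Fintype I]
    [Nonempty I] [DecidableEq I] (A : I → Type*) [∀ i, Fintype (A i)]
    [∀ i, Nonempty (A i)] [∀ i, DecidableEq (A i)]
    (u : ∀ _ : I, (∀ j, A j) → ℝ)
    (B : ∀ i, Set (A i)) (hBne : ∀ i, (B i).Nonempty)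
    (hclosed : ∀ i : I, ∀ σ : ∀ j, A j → ℝ,
      (∀ j, IsMixedStrategy (σ j)) →
      (∀ j, j ≠ i → ∀ a : A j, 0 < σ j a → a ∈ B j) →
      ∀ ai : A i,
        (∀ ai' : A i,
          expectedPayoff u (Function.update σ i (pureStrategy ai')) i ≤
            expectedPayoff u (Function.update σ i (pureStrategy ai)) i) →
        ai ∈ B i) :
    ∃ σstar : ∀ j, A j → ℝ,
      (∀ i, IsMixedStrategy (σstar i)) ∧
      (∀ i : I, ∀ a : A i, 0 < σstar i a → a ∈ B i) ∧
      ∀ i : I, ∀ σi : A i → ℝ, IsMixedStrategy σi →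
        expectedPayoff u (Function.update σstar i σi) i ≤ expectedPayoff u σstar i := by
  obtain ⟨σ, hσ, hsupp, hbest⟩ := exists_restricted_equilibrium u B hBne
  refine ⟨σ, hσ, hsupp, fun i τ hτ => ?_⟩
  obtain ⟨a₀, ha₀⟩ := Finite.exists_max fun a : A i =>
    expectedPayoff u (Function.update σ i (pureStrategy a)) i
  have ha₀B : a₀ ∈ B i := hclosed i σ hσ (fun j _ => hsupp j) a₀ ha₀
  have hself := expectedPayoff_update_eq_sum u σ i (σ i)
  rw [Function.update_eq_self] at hself
  rw [hself, expectedPayoff_update_eq_sum]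
  calc ∑ b, τ b * expectedPayoff u (Function.update σ i (pureStrategy b)) i
      ≤ ∑ b, τ b * expectedPayoff u (Function.update σ i (pureStrategy a₀)) i :=
        Finset.sum_le_sum fun b _ => mul_le_mul_of_nonneg_left (ha₀ b) (hτ.1 b)
    _ = ∑ b, σ i b * expectedPayoff u (Function.update σ i (pureStrategy a₀)) i := by
        rw [← Finset.sum_mul, ← Finset.sum_mul, hτ.2, (hσ i).2]
    _ ≤ ∑ b, σ i b * expectedPayoff u (Function.update σ i (pureStrategy b)) i := by
        refine Finset.sum_le_sum fun b _ => ?_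
        rcases ((hσ i).1 b).eq_or_lt with h | h
        · rw [← h, zero_mul, zero_mul]
        · exact mul_le_mul_of_nonneg_left (hbest i b h a₀ ha₀B) h.le
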